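/- Let R be a commutative ring with 1 whose group of units Rˣ is finitely generated. Let B₂⁰(R) ≤ SL₂(R) be the subgroup of upper triangular matrices of determinant 1, and let B₁(R) ≤ GL₂(R) be the subgroup of matrices with rows (u, r) and (0, 1), where u ∈ Rˣ and r ∈ R. Then B₂⁰(R) is finitely presented if and only if B₁(R) is finitely presented. -/

import Mathlib

/-- A group is finitely presented if it is isomorphic to the quotient of a
finitely generated free group by the normal closure of a finite set. -/
def IsFinitelyPresented (G : Type*) [Group G] : Prop :=
  ∃ (m : ℕ) (S : Finset (FreeGroup (Fin m))),
    Nonempty ((FreeGroup (Fin m) ⧸ Subgroup.normalClosure (S : Set (FreeGroup (Fin m)))) ≃* G)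

/-- A subgroup of finite index containing a finitely normally generated subgroup `N` contains it
as a finitely normally generated subgroup. -/
theorem Subgroup.IsFinitelyNormallyGenerated.subgroupOf {G : Type*} [Group G]
    {N H : Subgroup G} [H.FiniteIndex] (hN : N.IsFinitelyNormallyGenerated) (hNH : N ≤ H) :
    (N.subgroupOf H).IsFinitelyNormallyGenerated := by
  obtain ⟨S, hS, rfl⟩ := hN
  obtain ⟨R, hR, -⟩ := H.exists_isComplement_right 1
  have hRfin : R.Finite := hR.finite_right
  let T : Set H := H.subtype ⁻¹' Set.image2 (fun r s ↦ r * s * r⁻¹) R S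
  refine ⟨T, (hRfin.image2 _ hS).preimage H.subtype_injective.injOn, le_antisymm ?_ ?_⟩
  · refine Subgroup.normalClosure_le_normal ?_
    rintro h ⟨r, -, s, hs, hh⟩
    change (h : G) ∈ Subgroup.normalClosure S
    rw [show (h : G) = r * s * r⁻¹ from hh.symm]
    exact Subgroup.normalClosure_normal.conj_mem _ (Subgroup.subset_normalClosure hs) r
  · suffices h : Subgroup.normalClosure S ≤ (Subgroup.normalClosure T).map H.subtype by
      intro x hx
      obtain ⟨y, hy, hyx⟩ := h (show (x : G) ∈ Subgroup.normalClosure S from hx)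
      rwa [← H.subtype_injective hyx]
    refine (Subgroup.closure_le _).mpr fun g hg ↦ ?_
    obtain ⟨s, hs, hsg⟩ := Group.mem_conjugatesOfSet_iff.mp hg
    obtain ⟨x, rfl⟩ := isConj_iff.mp hsg
    obtain ⟨⟨⟨h, hh⟩, r, hr⟩, rfl⟩ := hR.2 x
    have hmem : r * s * r⁻¹ ∈ H :=
      hNH (Subgroup.normalClosure_normal.conj_mem _ (Subgroup.subset_normalClosure hs) r)
    refine ⟨⟨h, hh⟩ * ⟨_, hmem⟩ * ⟨h, hh⟩⁻¹, Subgroup.normalClosure_normal.conj_mem _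
      (Subgroup.subset_normalClosure (s := T) ⟨r, hr, s, hs, rfl⟩) _, ?_⟩
    simp [mul_assoc]

/-- The preimage of a subgroup of finite index has finite index. -/
theorem Subgroup.finiteIndex_comap {G H : Type*} [Group G] [Group H] (f : G →* H) (K : Subgroup H)
    [K.FiniteIndex] : (K.comap f).FiniteIndex :=
  ⟨by rw [K.index_comap]; exact (K.subgroupOf f.range).index_ne_zero_of_finite⟩

/-- If conjugation by `q x` acts on the image of a normal subgroup `N` as conjugation by `φ x` acts
on `N` for all `x` in a generating set, then it does so for all `x`. -/
theorem Subgroup.conj_map_eq_of_closure_eq_top {F G P : Type*} [Group F] [Group G] [Group P]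
    {N : Subgroup G} [N.Normal] (φ : F →* G) (q : F →* P) (ι : N →* P) {X : Set F}
    (hX : Subgroup.closure X = ⊤)
    (h : ∀ x ∈ X, ∀ a, q x * ι a * (q x)⁻¹ = ι (MulAut.conjNormal (φ x) a)) (x : F) (a : N) :
    q x * ι a * (q x)⁻¹ = ι (MulAut.conjNormal (φ x) a) := by
  induction hX ▸ Subgroup.mem_top x using Subgroup.closure_induction generalizing a with
  | mem x hx => exact h x hx a
  | one => simp
  | mul x y _ _ hx hy =>
    rw [map_mul φ, map_mul MulAut.conjNormal, MulAut.mul_apply, ← hx, ← hy]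
    simp [mul_assoc]
  | inv x _ hx =>
    have := hx (MulAut.conjNormal (φ x⁻¹) a)
    rw [← MulAut.mul_apply, ← map_mul, ← map_mul, mul_inv_cancel, map_one, map_one,
      MulAut.one_apply] at this
    simp [← this, mul_assoc]

namespace Group.IsFinitelyPresented

/-- A retract of a finitely presented group is finitely presented. -/
theorem of_leftInverse {F H : Type*} [Group F] [Group H] [hF : Group.IsFinitelyPresented F]
    (f : F →* H) (s : H →* F) (hs : Function.LeftInverse f s) :
    Group.IsFinitelyPresented H := by
  obtain ⟨n, φ, hφ, -⟩ := hF.out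
  refine of_surjective f hs.surjective
    ⟨Set.range fun i ↦ (φ (.of i))⁻¹ * s (f (φ (.of i))), Set.finite_range _, le_antisymm ?_ ?_⟩
  · refine Subgroup.normalClosure_le_normal ?_
    rintro _ ⟨i, rfl⟩
    simp [MonoidHom.mem_ker, hs _]
  · intro x hx
    set K := Subgroup.normalClosure (Set.range fun i ↦ (φ (.of i))⁻¹ * s (f (φ (.of i))))
    have key : (QuotientGroup.mk' K).comp φ = ((QuotientGroup.mk' K).comp (s.comp f)).comp φ :=
      FreeGroup.ext_hom _ _ fun i ↦
        QuotientGroup.eq.mpr (Subgroup.subset_normalClosure ⟨i, rfl⟩)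
    obtain ⟨y, rfl⟩ := hφ x
    have := DFunLike.congr_fun key y
    rw [MonoidHom.mem_ker] at hx
    rw [← QuotientGroup.eq_one_iff]
    simpa [hx] using this

/-- A finitely generated free group is finitely presented. -/
theorem of_isFreeGroup (H : Type*) [Group H] [IsFreeGroup H] [hH : Group.FG H] :
    Group.IsFinitelyPresented H := by
  obtain ⟨α, _, φ, hφ⟩ := Group.fg_iff_exists_freeGroup_hom_surjective_finite.mp hH
  refine of_leftInverse φ (IsFreeGroup.lift fun a ↦ Function.surjInv hφ (IsFreeGroup.of a)) ?_
  refine DFunLike.congr_fun (f := φ.comp _) (g := MonoidHom.id H) (IsFreeGroup.ext_hom fun a ↦ ?_)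
  simp [Function.surjInv_eq hφ]

/-- A subgroup of finite index in a finitely presented group is finitely presented. -/
theorem of_finiteIndex {G : Type*} [Group G] [hG : Group.IsFinitelyPresented G] (H : Subgroup G)
    [H.FiniteIndex] : Group.IsFinitelyPresented H := by
  obtain ⟨n, φ, hφ, hker⟩ := hG.out
  have := Subgroup.finiteIndex_comap φ H
  have : Group.IsFinitelyPresented (H.comap φ) := of_isFreeGroup _
  refine of_surjective (φ.subgroupComap H) (φ.subgroupComap_surjective_of_surjective H hφ) ?_
  have hle : φ.ker ≤ H.comap φ := fun x hx ↦ by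
    simp [Subgroup.mem_comap, MonoidHom.mem_ker.mp hx]
  convert hker.subgroupOf hle
  ext x
  exact Subtype.ext_iff

/-- A finitely presented group is finitely generated. -/
theorem fg (G : Type*) [Group G] [hG : Group.IsFinitelyPresented G] : Group.FG G := by
  obtain ⟨n, φ, hφ, -⟩ := hG.out
  exact Group.fg_of_surjective hφ

open Monoid in
/-- An extension of a finitely presented group by a finitely presented group is finitely
presented. -/
theorem of_extension {G Q : Type*} [Group G] [Group Q] (f : G →* Q)
    (hf : Function.Surjective f) [hN : Group.IsFinitelyPresented f.ker]
    [hQ : Group.IsFinitelyPresented Q] : Group.IsFinitelyPresented G := by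
  classical
  obtain ⟨n, ψ, hψ, T, hT, hTker⟩ := hQ.out
  obtain ⟨A, hA, hAfin⟩ := Group.fg_iff.mp (fg f.ker)
  let b : FreeGroup (Fin n) →* G := FreeGroup.lift fun i ↦ Function.surjInv hf (ψ (.of i))
  have hb : f.comp b = ψ := FreeGroup.ext_hom _ _ fun i ↦ by simp [b, Function.surjInv_eq hf]
  have hb' (y) : f (b y) = ψ y := DFunLike.congr_fun hb y
  let φ : Coprod f.ker (FreeGroup (Fin n)) →* G := Coprod.lift f.ker.subtype b
  have hφl (a : f.ker) : φ (Coprod.inl a) = a := by simp [φ]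
  have hφr (y) : φ (Coprod.inr y) = b y := by simp [φ]
  have hφ : Function.Surjective φ := fun g ↦ by
    obtain ⟨y, hy⟩ := hψ (f g)
    have hg : g * (b y)⁻¹ ∈ f.ker := by simp [MonoidHom.mem_ker, hb', hy]
    exact ⟨Coprod.inl ⟨_, hg⟩ * Coprod.inr y, by rw [map_mul, hφl, hφr]; simp⟩
  let R₁ : Set (Coprod f.ker (FreeGroup (Fin n))) := Set.image2 (fun i a ↦
    (Coprod.inr (.of i) * Coprod.inl a * (Coprod.inr (.of i))⁻¹)⁻¹ *
      Coprod.inl (MulAut.conjNormal (b (.of i)) a)) Set.univ A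
  let R₂ : Set (Coprod f.ker (FreeGroup (Fin n))) :=
    {x | ∃ t ∈ T, ∃ a : f.ker, (a : G) = b t ∧ (Coprod.inl a)⁻¹ * Coprod.inr t = x}
  have hR₂ : R₂.Finite := by
    refine (hT.image fun t ↦ if h : b t ∈ f.ker then
      (Coprod.inl (⟨b t, h⟩ : f.ker))⁻¹ * Coprod.inr t else 1).subset ?_
    rintro _ ⟨t, ht, a, hat, rfl⟩
    refine ⟨t, ht, ?_⟩
    simp [← hat]
  refine of_surjective φ hφ ⟨R₁ ∪ R₂, (Set.finite_univ.image2 _ hAfin).union hR₂, ?_⟩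
  set K := Subgroup.normalClosure (R₁ ∪ R₂)
  have hKφ : K ≤ φ.ker := by
    refine Subgroup.normalClosure_le_normal ?_
    rintro _ (⟨i, -, a, -, rfl⟩ | ⟨t, -, a, hat, rfl⟩)
    · simp [MonoidHom.mem_ker, hφl, hφr, mul_assoc]
    · simp [MonoidHom.mem_ker, hφl, hφr, hat]
  refine le_antisymm hKφ ?_
  let q := QuotientGroup.mk' K
  have hq {x y} (h : x⁻¹ * y ∈ R₁ ∪ R₂) : q x = q y :=
    QuotientGroup.eq.mpr (Subgroup.subset_normalClosure h)
  have hX : Subgroup.closure (Set.range (Coprod.inl : f.ker →* _) ∪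
      Coprod.inr '' Set.range (FreeGroup.of (α := Fin n))) = ⊤ := by
    rw [Subgroup.closure_union, ← MonoidHom.map_closure, FreeGroup.closure_range_of,
      ← MonoidHom.range_eq_map, ← MonoidHom.coe_range, Subgroup.closure_eq,
      Coprod.range_inl_sup_range_inr]
  have conj := Subgroup.conj_map_eq_of_closure_eq_top φ q (q.comp Coprod.inl) hX <| by
    rintro _ (⟨m, rfl⟩ | ⟨_, ⟨i, rfl⟩, rfl⟩)
    · intro a
      simp only [MonoidHom.comp_apply, ← map_inv, ← map_mul]
      congr 2
    · refine DFunLike.congr_fun (f := (MulAut.conj (q (Coprod.inr (.of i)))).toMonoidHom.comp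
        (q.comp Coprod.inl)) (g := (q.comp Coprod.inl).comp (MulAut.conjNormal _).toMonoidHom)
        (MonoidHom.eq_of_eqOn_dense hA fun a ha ↦ hq (.inl ⟨i, trivial, a, ha, ?_⟩))
      rw [hφr]
      rfl
  let D := (q.comp (Coprod.inl : f.ker →* _)).range
  have : D.Normal := by
    refine ⟨?_⟩
    rintro _ ⟨a, rfl⟩ g
    obtain ⟨x, rfl⟩ := QuotientGroup.mk'_surjective K g
    exact ⟨_, (conj x a).symm⟩
  have hTD : ψ.ker ≤ D.comap (q.comp Coprod.inr) := by
    rw [← hTker]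
    refine Subgroup.normalClosure_le_normal fun t ht ↦ ?_
    have htk : b t ∈ f.ker := by
      rw [MonoidHom.mem_ker, hb', ← MonoidHom.mem_ker, ← hTker]
      exact Subgroup.subset_normalClosure ht
    exact ⟨⟨b t, htk⟩, hq (.inr ⟨t, ht, _, rfl, rfl⟩)⟩
  have hsnd : (QuotientGroup.mk' D).comp q =
      ((QuotientGroup.mk' D).comp (q.comp Coprod.inr)).comp Coprod.snd := by
    refine Coprod.hom_ext (MonoidHom.ext fun a ↦ ?_) (MonoidHom.ext fun y ↦ by simp)
    simpa only [MonoidHom.comp_apply, Coprod.snd_apply_inl, map_one] using!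
      (QuotientGroup.eq_one_iff _).mpr (⟨a, rfl⟩ : q (Coprod.inl a) ∈ D)
  have hfφ : f.comp φ = ψ.comp Coprod.snd := by
    refine Coprod.hom_ext (MonoidHom.ext fun a ↦ ?_) (MonoidHom.ext fun y ↦ by simp [hφr, hb'])
    simpa [hφl] using! MonoidHom.mem_ker.mp a.2
  intro x hx
  have hψx : Coprod.snd x ∈ ψ.ker := by
    rw [MonoidHom.mem_ker, ← MonoidHom.comp_apply, ← hfφ, MonoidHom.comp_apply,
      MonoidHom.mem_ker.mp hx, map_one]
  obtain ⟨a, ha⟩ : q x ∈ D := (QuotientGroup.eq_one_iff _).mp <|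
    (DFunLike.congr_fun hsnd x).trans ((QuotientGroup.eq_one_iff _).mpr (hTD hψx))
  have hax : (Coprod.inl a)⁻¹ * x ∈ K := QuotientGroup.eq.mp ha
  have ha1 : a = 1 := by
    have := hKφ hax
    rw [MonoidHom.mem_ker, map_mul, MonoidHom.mem_ker.mp hx, map_inv, hφl] at this
    ext
    simpa using this
  simpa [ha1] using hax

/-- A group with a finitely presented subgroup of finite index is finitely presented. -/
theorem of_subgroup_finiteIndex {G : Type*} [Group G] (H : Subgroup G) [H.FiniteIndex]
    [Group.IsFinitelyPresented H] : Group.IsFinitelyPresented G := by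
  have := of_finiteIndex (H.normalCore.subgroupOf H)
  have : Group.IsFinitelyPresented H.normalCore :=
    equiv (Subgroup.subgroupOfEquivOfLe H.normalCore_le)
  have : Group.IsFinitelyPresented (QuotientGroup.mk' H.normalCore).ker := by
    rwa [QuotientGroup.ker_mk']
  exact of_extension _ (QuotientGroup.mk'_surjective H.normalCore)

/-- Finite presentability is invariant under homomorphisms with finite kernel and image of finite
index. -/
theorem iff_of_finite_ker_of_finiteIndex_range {G H : Type*} [Group G] [Group H] (f : G →* H)
    [hf : Finite f.ker] [f.range.FiniteIndex] :
    Group.IsFinitelyPresented G ↔ Group.IsFinitelyPresented H := by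
  rw [← f.ker_rangeRestrict] at hf
  constructor
  · intro _
    have := of_surjective f.rangeRestrict f.rangeRestrict_surjective (.of_FG _)
    exact of_subgroup_finiteIndex f.range
  · intro _
    have := of_finiteIndex f.range
    exact of_extension f.rangeRestrict f.rangeRestrict_surjective

end Group.IsFinitelyPresented

/-- `IsFinitelyPresented` agrees with the notion in the library. -/
theorem isFinitelyPresented_iff (G : Type*) [Group G] :
    IsFinitelyPresented G ↔ Group.IsFinitelyPresented G := by
  constructor
  · rintro ⟨m, S, ⟨e⟩⟩
    have := Group.IsFinitelyPresented.quotient (Subgroup.normalClosure (S : Set (FreeGroup (Fin m))))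
      ⟨S, S.finite_toSet, rfl⟩
    exact .equiv e
  · rintro ⟨m, φ, hφ, S, hS, hSφ⟩
    refine ⟨m, hS.toFinset, ⟨?_⟩⟩
    exact (QuotientGroup.quotientMulEquivOfEq (by rw [hS.coe_toFinset, hSφ])).trans
      (QuotientGroup.quotientKerEquivOfSurjective φ hφ)

/-- The kernel of the `n`-th power map on a finitely generated commutative group is finite. -/
theorem CommGroup.finite_ker_powMonoidHom (G : Type*) [CommGroup G] [hG : Group.FG G] {n : ℕ}
    (hn : n ≠ 0) : Finite (powMonoidHom n : G →* G).ker := by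
  have : Module.Finite ℤ (Additive G) := Module.Finite.iff_addGroup_fg.mpr inferInstance
  have : Group.FG (powMonoidHom n : G →* G).ker := by
    rw [Group.fg_iff_subgroup_fg, Subgroup.fg_iff_add_fg, ← AddSubgroup.toIntSubmodule_toAddSubgroup
      (powMonoidHom n : G →* G).ker.toAddSubgroup, ← Submodule.fg_iff_addSubgroup_fg]
    exact IsNoetherian.noetherian _
  exact CommGroup.finite_of_fg_isMulTorsion _ fun x ↦
    isOfFinOrder_iff_pow_eq_one.mpr ⟨n, hn.bot_lt, Subtype.ext x.2⟩

/-- The `n`-th powers in a finitely generated commutative group form a subgroup of finite index. -/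
theorem CommGroup.finiteIndex_range_powMonoidHom (G : Type*) [CommGroup G] [Group.FG G] {n : ℕ}
    (hn : n ≠ 0) : (powMonoidHom n : G →* G).range.FiniteIndex := by
  have : Finite (G ⧸ (powMonoidHom n : G →* G).range) := by
    refine CommGroup.finite_of_fg_isMulTorsion _ fun x ↦ ?_
    obtain ⟨g, rfl⟩ := QuotientGroup.mk_surjective x
    exact isOfFinOrder_iff_pow_eq_one.mpr
      ⟨n, hn.bot_lt, (QuotientGroup.eq_one_iff _).mpr ⟨g, rfl⟩⟩
  exact Subgroup.finiteIndex_of_finite_quotient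

section Borel

open Matrix

variable {R : Type*} [CommRing R]

/-- The diagonal character `(u, r; 0, u⁻¹) ↦ u` of a group of upper triangular matrices of
determinant one. -/
def diagonalCharacter (B0 : Subgroup (SpecialLinearGroup (Fin 2) R))
    (hB0 : ∀ g ∈ B0, (g : Matrix (Fin 2) (Fin 2) R) 1 0 = 0) : B0 →* Rˣ where
  toFun g := ⟨g.1 0 0, g.1 1 1,
    by simpa [hB0 g.1 g.2] using (Matrix.det_fin_two g.1.1).symm.trans g.1.2,
    by simpa [hB0 g.1 g.2, mul_comm] using (Matrix.det_fin_two g.1.1).symm.trans g.1.2⟩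
  map_one' := by ext; simp
  map_mul' g h := by ext; simp [Matrix.mul_apply, Fin.sum_univ_two, hB0 h.1 h.2]

/-- The homomorphism `(u, r; 0, u⁻¹) ↦ (u ^ 2, u * r; 0, 1)` that multiplies an upper triangular
matrix of determinant one by its upper left entry. -/
def scaleByDiagonal (B0 : Subgroup (SpecialLinearGroup (Fin 2) R))
    (hB0 : ∀ g ∈ B0, (g : Matrix (Fin 2) (Fin 2) R) 1 0 = 0) : B0 →* GL (Fin 2) R where
  toFun g := GeneralLinearGroup.scalar (Fin 2) (diagonalCharacter B0 hB0 g) *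
    SpecialLinearGroup.toGL g.1
  map_one' := by simp
  map_mul' g h := by
    simp only [map_mul, Subgroup.coe_mul, mul_assoc]
    congr 1
    rw [← mul_assoc, ← mul_assoc, GeneralLinearGroup.scalar_commute]

theorem scaleByDiagonal_apply (B0 : Subgroup (SpecialLinearGroup (Fin 2) R))
    (hB0 : ∀ g ∈ B0, (g : Matrix (Fin 2) (Fin 2) R) 1 0 = 0) (g : B0) (i j : Fin 2) :
    (scaleByDiagonal B0 hB0 g : Matrix (Fin 2) (Fin 2) R) i j = g.1 0 0 * g.1 i j := by
  simp [scaleByDiagonal, diagonalCharacter]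

theorem finite_ker_scaleByDiagonal (hU : Group.FG Rˣ)
    (B0 : Subgroup (SpecialLinearGroup (Fin 2) R))
    (hB0 : ∀ g ∈ B0, (g : Matrix (Fin 2) (Fin 2) R) 1 0 = 0) :
    Finite (scaleByDiagonal B0 hB0).ker := by
  have := CommGroup.finite_ker_powMonoidHom Rˣ two_ne_zero
  have entry (g : (scaleByDiagonal B0 hB0).ker) (i j : Fin 2) :
      g.1.1 0 0 * g.1.1 i j = (1 : Matrix (Fin 2) (Fin 2) R) i j := by
    rw [← scaleByDiagonal_apply B0 hB0, MonoidHom.mem_ker.mp g.2, Units.val_one]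
  have hsq (g : (scaleByDiagonal B0 hB0).ker) :
      diagonalCharacter B0 hB0 g.1 ∈ (powMonoidHom 2 : Rˣ →* Rˣ).ker :=
    Units.ext (by simpa [sq, diagonalCharacter] using entry g 0 0)
  refine Finite.of_injective
    (fun g ↦ (⟨_, hsq g⟩ : (powMonoidHom 2 : Rˣ →* Rˣ).ker)) fun g h hgh ↦ ?_
  have h0 : g.1.1 0 0 = h.1.1 0 0 := congrArg Units.val (Subtype.ext_iff.mp hgh)
  ext i j
  refine (diagonalCharacter B0 hB0 g.1).isUnit.mul_left_cancel ?_
  change g.1.1 0 0 * g.1.1 i j = g.1.1 0 0 * h.1.1 i j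
  rw [entry, h0, entry]

end Borel


/-- For a commutative ring R with finitely generated unit group, the upper triangular
subgroup B₂⁰(R) ≤ SL₂(R) is finitely presented iff the subgroup B₁(R) ≤ GL₂(R) of
matrices with rows (u, r), (0, 1) is finitely presented. -/
theorem borelSL2_finitelyPresented_iff_B1
    (R : Type*) [CommRing R] (hU : Group.FG Rˣ)
    (B0 : Subgroup (Matrix.SpecialLinearGroup (Fin 2) R))
    (hB0 : ∀ g : Matrix.SpecialLinearGroup (Fin 2) R, g ∈ B0 ↔
      (g : Matrix (Fin 2) (Fin 2) R) 1 0 = 0)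
    (B1 : Subgroup (Matrix.GeneralLinearGroup (Fin 2) R))
    (hB1 : ∀ g : Matrix.GeneralLinearGroup (Fin 2) R, g ∈ B1 ↔
      (g : Matrix (Fin 2) (Fin 2) R) 1 0 = 0 ∧
      (g : Matrix (Fin 2) (Fin 2) R) 1 1 = 1) :
    IsFinitelyPresented ↥B0 ↔ IsFinitelyPresented ↥B1 := by
  have hB0' : ∀ g ∈ B0, (g : Matrix (Fin 2) (Fin 2) R) 1 0 = 0 := fun g ↦ (hB0 g).mp
  have hdiag (g : B0) : g.1 0 0 * g.1 1 1 = 1 := by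
    simpa [hB0' g.1 g.2] using (Matrix.det_fin_two g.1.1).symm.trans g.1.2
  let f : B0 →* B1 := (scaleByDiagonal B0 hB0').codRestrict B1 fun g ↦ (hB1 _).mpr
    ⟨by simp [scaleByDiagonal_apply, hB0' g.1 g.2], by rw [scaleByDiagonal_apply, hdiag]⟩
  have : Finite f.ker := by
    rw [MonoidHom.ker_codRestrict]
    exact finite_ker_scaleByDiagonal hU B0 hB0'
  have : f.range.FiniteIndex := by
    have := CommGroup.finiteIndex_range_powMonoidHom Rˣ two_ne_zero
    let d : B1 →* Rˣ := Matrix.GeneralLinearGroup.det.comp B1.subtype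
    have := Subgroup.finiteIndex_comap d (powMonoidHom 2 : Rˣ →* Rˣ).range
    refine Subgroup.finiteIndex_of_le (H := (powMonoidHom 2 : Rˣ →* Rˣ).range.comap d) ?_
    rintro ⟨b, hb⟩ ⟨v, hv⟩
    obtain ⟨h10, h11⟩ := (hB1 b).mp hb
    have h00 : (v : R) ^ 2 = b 0 0 := by
      simpa [d, Matrix.det_fin_two, h10, h11] using congrArg Units.val hv
    let g : Matrix.SpecialLinearGroup (Fin 2) R :=
      ⟨!![(v : R), ↑v⁻¹ * b 0 1; 0, ↑v⁻¹], by simp [Matrix.det_fin_two]⟩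
    refine ⟨⟨g, (hB0 g).mpr (by simp [g])⟩, ?_⟩
    ext i j
    refine (scaleByDiagonal_apply B0 hB0' _ i j).trans ?_
    fin_cases i <;> fin_cases j <;> simp [g, h10, h11, ← h00, sq]
  rw [isFinitelyPresented_iff, isFinitelyPresented_iff]
  exact Group.IsFinitelyPresented.iff_of_finite_ker_of_finiteIndex_range f
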